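/- arXiv:0908.3163 — 2 statements merged into one kernel-verified Lean document; each statement's English description precedes it below -/
import Mathlib

section
/- Let α > 1/2, Q > 0, γ > 0 and 0 < c < 1. Then there exist a constant C = C(γ,α,Q,c) > 0 and n₀ ∈ ℕ such that for all integers n ≥ n₀, all g ∈ Θ_s(α,Q), and all integers k with 0 ≤ k ≤ c·n^γ: Σ_{m=⌊n^γ⌋}^∞ |s_{k,m}| ≤ C·n^{γ(1/2−α)}, where s_{k,m} := ∫₀¹ g(x)·f_k²(x)·cos(mπx) dx. The same bound (with γ = 0, i.e. Σ_{m=1}^∞ |s_{0,m}| ≤ C) holds for k = 0 and α > 1/2. -/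
open MeasureTheory

noncomputable section

/-- `f₀ ≡ 1` and `f_k(x) = √2 · cos(kπx/2)` for `k ≥ 1`. -/
def fk (k : ℕ) (x : ℝ) : ℝ :=
  if k = 0 then 1 else Real.sqrt 2 * Real.cos (k * Real.pi * x / 2)

/-- Membership in the Sobolev s-ellipsoid `Θ_s(α,Q)`. -/
def memThetaS (α Q : ℝ) (g : ℝ → ℝ) : Prop :=
  ∃ θ : ℕ → ℝ,
    (∀ x ∈ Set.Icc (0:ℝ) 1,
      g x = θ 0 + 2 * ∑' i : ℕ, θ (i + 1) * Real.cos (((i : ℝ) + 1) * Real.pi * x)) ∧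
    Summable (fun i : ℕ => ((i : ℝ) + 1) ^ (2 * α) * (θ (i + 1)) ^ 2) ∧
    ∑' i : ℕ, ((i : ℝ) + 1) ^ (2 * α) * (θ (i + 1)) ^ 2 ≤ Q

/-- The scaled Fourier coefficient `s_{k,m} = ∫₀¹ g(x) f_k²(x) cos(mπx) dx`. -/
def skm (g : ℝ → ℝ) (k m : ℕ) : ℝ :=
  ∫ x in (0:ℝ)..1, g x * (fk k x) ^ 2 * Real.cos ((m : ℝ) * Real.pi * x)

theorem integral_cos_int_mul_pi {z : ℤ} (hz : z ≠ 0) :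
    ∫ x in (0:ℝ)..1, Real.cos ((z : ℝ) * Real.pi * x) = 0 := by
  have h : (z : ℝ) * Real.pi ≠ 0 := mul_ne_zero (by exact_mod_cast hz) Real.pi_ne_zero
  rw [intervalIntegral.integral_comp_mul_left (fun x => Real.cos x) h, integral_cos]
  simp [Real.sin_int_mul_pi]

theorem integral_cos_mul_cos {a m : ℕ} (hm : m ≠ 0) :
    ∫ x in (0:ℝ)..1, Real.cos ((a : ℝ) * Real.pi * x) * Real.cos ((m : ℝ) * Real.pi * x) =
      if a = m then 1 / 2 else 0 := by
  have h (x : ℝ) : Real.cos ((a : ℝ) * Real.pi * x) * Real.cos ((m : ℝ) * Real.pi * x) =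
      1 / 2 * (Real.cos ((((a : ℤ) - m : ℤ) : ℝ) * Real.pi * x) +
        Real.cos ((((a : ℤ) + m : ℤ) : ℝ) * Real.pi * x)) := by
    push_cast
    rw [sub_mul, sub_mul, add_mul, add_mul, Real.cos_sub, Real.cos_add]
    ring
  simp_rw [h]
  rw [intervalIntegral.integral_const_mul, intervalIntegral.integral_add
    (Continuous.intervalIntegrable (by fun_prop) _ _)
    (Continuous.intervalIntegrable (by fun_prop) _ _),
    integral_cos_int_mul_pi (z := (a : ℤ) + m) (by omega)]
  split_ifs with ham
  · simp [ham]
  · rw [integral_cos_int_mul_pi (by omega)]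
    simp

/-- The tail of a convergent `p`-series is controlled by a telescoping sum. -/
theorem rpow_neg_le_telescope {q : ℝ} (hq : 0 < q) {i : ℝ} (hi : 1 ≤ i) :
    i ^ (-(q + 1)) ≤ 2 ^ (q + 1) / q * (i ^ (-q) - (i + 1) ^ (-q)) := by
  have hi0 : 0 < i := by linarith
  have hi1 : 0 < i + 1 := by linarith
  have hlog : 1 / (i + 1) ≤ Real.log ((i + 1) / i) := by
    have h := Real.one_sub_inv_le_log_of_pos (div_pos hi1 hi0)
    convert h using 1
    field_simp
    ring
  have hexp : 1 + q / (i + 1) ≤ ((i + 1) / i) ^ q := by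
    rw [Real.rpow_def_of_pos (div_pos hi1 hi0)]
    have h1 := Real.add_one_le_exp (Real.log ((i + 1) / i) * q)
    have h2 := mul_le_mul_of_nonneg_right hlog hq.le
    have h3 : 1 / (i + 1) * q = q / (i + 1) := by ring
    linarith
  have hmul : (i + 1) ^ (-q) * ((i + 1) / i) ^ q = i ^ (-q) := by
    rw [Real.div_rpow hi1.le hi0.le, Real.rpow_neg hi1.le, Real.rpow_neg hi0.le]
    have := (Real.rpow_pos_of_pos hi1 q).ne'
    field_simp
  have hstep : q * (i + 1) ^ (-(q + 1)) ≤ i ^ (-q) - (i + 1) ^ (-q) := by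
    have h1 := mul_le_mul_of_nonneg_left hexp (Real.rpow_nonneg hi1.le (-q))
    have h2 : (i + 1) ^ (-(q + 1)) = (i + 1) ^ (-q) / (i + 1) := by
      rw [neg_add, ← sub_eq_add_neg, Real.rpow_sub_one hi1.ne']
    rw [hmul] at h1
    rw [h2]
    have h3 : (i + 1) ^ (-q) * (1 + q / (i + 1)) =
      (i + 1) ^ (-q) + q * ((i + 1) ^ (-q) / (i + 1)) := by ring
    linarith
  have hdouble : i ^ (-(q + 1)) ≤ 2 ^ (q + 1) * (i + 1) ^ (-(q + 1)) := by
    have h1 : (2 * i) ^ (-(q + 1)) ≤ (i + 1) ^ (-(q + 1)) :=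
      Real.rpow_le_rpow_of_nonpos hi1 (by linarith) (by linarith)
    rw [Real.mul_rpow (by norm_num) hi0.le, Real.rpow_neg (by norm_num)] at h1
    have h2 : (0:ℝ) < 2 ^ (q + 1) := by positivity
    calc i ^ (-(q + 1)) = 2 ^ (q + 1) * (((2:ℝ) ^ (q + 1))⁻¹ * i ^ (-(q + 1))) := by
          field_simp
      _ ≤ _ := by gcongr
  calc i ^ (-(q + 1)) ≤ 2 ^ (q + 1) * (i + 1) ^ (-(q + 1)) := hdouble
    _ = 2 ^ (q + 1) / q * (q * (i + 1) ^ (-(q + 1))) := by field_simp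
    _ ≤ _ := by gcongr

theorem summable_tail_rpow_neg {q : ℝ} (hq : 0 < q) {M : ℕ} (hM : 1 ≤ M) :
    Summable (fun j : ℕ => ((M + j : ℕ) : ℝ) ^ (-(q + 1))) ∧
      ∑' j : ℕ, ((M + j : ℕ) : ℝ) ^ (-(q + 1)) ≤ 2 ^ (q + 1) / q * (M : ℝ) ^ (-q) := by
  have hbound (n : ℕ) : ∑ j ∈ Finset.range n, ((M + j : ℕ) : ℝ) ^ (-(q + 1)) ≤
      2 ^ (q + 1) / q * (M : ℝ) ^ (-q) := by
    calc _ ≤ ∑ j ∈ Finset.range n, 2 ^ (q + 1) / q *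
          (((M + j : ℕ) : ℝ) ^ (-q) - ((M + (j + 1) : ℕ) : ℝ) ^ (-q)) := by
          refine Finset.sum_le_sum fun j _ => ?_
          have h := rpow_neg_le_telescope hq (i := ((M + j : ℕ) : ℝ))
            (by exact_mod_cast (by omega : 1 ≤ M + j))
          rw [← add_assoc, Nat.cast_add_one (M + j)]
          exact h
      _ = 2 ^ (q + 1) / q * ((M : ℝ) ^ (-q) - ((M + n : ℕ) : ℝ) ^ (-q)) := by
          rw [← Finset.mul_sum, Finset.sum_range_sub' (fun j => ((M + j : ℕ) : ℝ) ^ (-q))]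
          simp
      _ ≤ _ := by
          gcongr
          have : 0 ≤ ((M + n : ℕ) : ℝ) ^ (-q) := by positivity
          linarith
  exact ⟨summable_of_sum_range_le (fun _ => by positivity) hbound,
    Real.tsum_le_of_sum_range_le (fun _ => by positivity) hbound⟩

theorem summable_abs_tail_of_weighted {α Q : ℝ} (hα : 1 / 2 < α) {θ : ℕ → ℝ}
    (hs : Summable (fun i : ℕ => ((i : ℝ) + 1) ^ (2 * α) * (θ (i + 1)) ^ 2))
    (hQ : ∑' i : ℕ, ((i : ℝ) + 1) ^ (2 * α) * (θ (i + 1)) ^ 2 ≤ Q) {M : ℕ} (hM : 1 ≤ M) :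
    Summable (fun j : ℕ => |θ (M + j)|) ∧
      ∑' j : ℕ, |θ (M + j)| ≤
        (Q + 2 ^ (2 * α) / (2 * α - 1)) * (M : ℝ) ^ (1 / 2 - α) := by
  obtain ⟨hp, hp'⟩ := summable_tail_rpow_neg (q := 2 * α - 1) (by linarith) hM
  rw [sub_add_cancel] at hp hp'
  have hM0 : (0:ℝ) < M := by exact_mod_cast hM
  set l := (M : ℝ) ^ (1 / 2 - α) with hl
  have hl0 : 0 < l := by positivity
  have hl2 : (M : ℝ) ^ (-(2 * α - 1)) = l * l := by
    rw [hl, ← Real.rpow_add hM0]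
    ring_nf
  let w : ℕ → ℝ := fun j => ((M + j : ℕ) : ℝ) ^ (2 * α) * θ (M + j) ^ 2
  have hw : w = fun j : ℕ => (((j + (M - 1) : ℕ) : ℝ) + 1) ^ (2 * α) *
      θ (j + (M - 1) + 1) ^ 2 := by
    funext j
    have h : M + j = j + (M - 1) + 1 := by omega
    simp only [w]
    rw [h, Nat.cast_add_one]
  have hws : Summable w := by
    rw [hw]
    exact hs.comp_injective (add_left_injective (M - 1))
  have hwQ : ∑' j, w j ≤ Q := by
    refine le_trans ?_ hQ
    rw [hw]
    exact tsum_comp_le_tsum_of_inj (i := fun j : ℕ => j + (M - 1)) hs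
      (fun i => by positivity) (add_left_injective (M - 1))
  have hle (j : ℕ) : |θ (M + j)| ≤ l * w j + l⁻¹ * ((M + j : ℕ) : ℝ) ^ (-(2 * α)) := by
    have hj : (0:ℝ) < ((M + j : ℕ) : ℝ) := by exact_mod_cast (by omega : 0 < M + j)
    have hb : (0:ℝ) < ((M + j : ℕ) : ℝ) ^ α := by positivity
    have h1 : ((M + j : ℕ) : ℝ) ^ (2 * α) = (((M + j : ℕ) : ℝ) ^ α) ^ 2 := by
      rw [mul_comm, Real.rpow_mul hj.le, Real.rpow_two]
    simp only [w]
    rw [Real.rpow_neg hj.le, h1, ← sq_abs (θ (M + j))]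
    set b := ((M + j : ℕ) : ℝ) ^ α
    set t := |θ (M + j)|
    have ht : 0 ≤ t := abs_nonneg _
    have h2 : l * (b ^ 2 * t ^ 2) + l⁻¹ * (b ^ 2)⁻¹ - t =
        l * (b * t - (2 * l * b)⁻¹) ^ 2 + 3 / 4 * (l⁻¹ * (b ^ 2)⁻¹) := by
      field_simp
      ring
    have h3 : 0 ≤ l * (b * t - (2 * l * b)⁻¹) ^ 2 + 3 / 4 * (l⁻¹ * (b ^ 2)⁻¹) := by positivity
    linarith
  have hsum := (hws.mul_left l).add (hp.mul_left l⁻¹)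
  have hsθ : Summable (fun j : ℕ => |θ (M + j)|) :=
    Summable.of_nonneg_of_le (fun _ => abs_nonneg _) hle hsum
  refine ⟨hsθ, (hsθ.tsum_le_tsum hle hsum).trans ?_⟩
  rw [(hws.mul_left l).tsum_add (hp.mul_left l⁻¹), tsum_mul_left, tsum_mul_left]
  rw [hl2] at hp'
  calc l * ∑' j, w j + l⁻¹ * ∑' j : ℕ, ((M + j : ℕ) : ℝ) ^ (-(2 * α))
      ≤ l * Q + l⁻¹ * (2 ^ (2 * α) / (2 * α - 1) * (l * l)) := by gcongr
    _ = _ := by field_simp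

theorem integral_cosine_series_mul_cos {θ : ℕ → ℝ} (hθ : Summable (fun i : ℕ => |θ (i + 1)|))
    {m : ℕ} (hm : m ≠ 0) :
    ∫ x in (0:ℝ)..1,
      (θ 0 + 2 * ∑' i : ℕ, θ (i + 1) * Real.cos (((i : ℝ) + 1) * Real.pi * x)) *
        Real.cos ((m : ℝ) * Real.pi * x) = θ m := by
  have hterm (i : ℕ) (x : ℝ) :
      ‖θ (i + 1) * Real.cos (((i : ℝ) + 1) * Real.pi * x)‖ ≤ |θ (i + 1)| := by
    rw [norm_mul]
    exact mul_le_of_le_one_right (abs_nonneg _) (Real.abs_cos_le_one _)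
  have hcont : Continuous
      (fun x : ℝ => ∑' i : ℕ, θ (i + 1) * Real.cos (((i : ℝ) + 1) * Real.pi * x)) :=
    continuous_tsum (fun i => by fun_prop) hθ hterm
  have hser : HasSum (fun i : ℕ => ∫ x in (0:ℝ)..1,
      θ (i + 1) * Real.cos (((i : ℝ) + 1) * Real.pi * x) * Real.cos ((m : ℝ) * Real.pi * x))
      (∫ x in (0:ℝ)..1, (∑' i : ℕ, θ (i + 1) * Real.cos (((i : ℝ) + 1) * Real.pi * x)) *
        Real.cos ((m : ℝ) * Real.pi * x)) := by
    refine intervalIntegral.hasSum_integral_of_dominated_convergence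
      (fun i _ => |θ (i + 1)|) (fun i => (Continuous.aestronglyMeasurable (by fun_prop)))
      (fun i => ?_) ?_ ?_ ?_
    · refine Filter.Eventually.of_forall fun x _ => ?_
      rw [norm_mul]
      exact (mul_le_of_le_one_right (norm_nonneg _) (Real.abs_cos_le_one _)).trans (hterm i x)
    · exact Filter.Eventually.of_forall fun _ _ => hθ
    · exact intervalIntegrable_const
    · refine Filter.Eventually.of_forall fun x _ => ?_
      exact (Summable.of_norm_bounded hθ (hterm · x)).hasSum.mul_right _
  have hcoef (i : ℕ) : ∫ x in (0:ℝ)..1,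
      θ (i + 1) * Real.cos (((i : ℝ) + 1) * Real.pi * x) * Real.cos ((m : ℝ) * Real.pi * x) =
      if i = m - 1 then θ m * (1 / 2) else 0 := by
    simp_rw [mul_assoc (θ (i + 1))]
    have h := integral_cos_mul_cos (a := i + 1) hm
    push_cast at h
    rw [intervalIntegral.integral_const_mul, h]
    by_cases him : i + 1 = m
    · rw [if_pos him, if_pos (by omega), him]
    · simp [him, show i ≠ m - 1 by omega]
  rw [funext hcoef] at hser
  have hval := hser.unique (hasSum_ite_eq (m - 1) (θ m * (1 / 2)))
  have hzero : ∫ x in (0:ℝ)..1, Real.cos ((m : ℝ) * Real.pi * x) = 0 := by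
    exact_mod_cast integral_cos_int_mul_pi (z := (m : ℤ)) (by exact_mod_cast hm)
  have hsplit (x : ℝ) :
      (θ 0 + 2 * ∑' i : ℕ, θ (i + 1) * Real.cos (((i : ℝ) + 1) * Real.pi * x)) *
        Real.cos ((m : ℝ) * Real.pi * x) = θ 0 * Real.cos ((m : ℝ) * Real.pi * x) +
          2 * ((∑' i : ℕ, θ (i + 1) * Real.cos (((i : ℝ) + 1) * Real.pi * x)) *
            Real.cos ((m : ℝ) * Real.pi * x)) := by ring
  rw [funext hsplit, intervalIntegral.integral_add (Continuous.intervalIntegrable (by fun_prop) _ _)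
    (Continuous.intervalIntegrable (by fun_prop) _ _), intervalIntegral.integral_const_mul,
    intervalIntegral.integral_const_mul, hval, hzero]
  ring

theorem abs_skm_le {g : ℝ → ℝ} {θ : ℕ → ℝ} (hθ : Summable (fun i : ℕ => |θ (i + 1)|))
    (hg : ∀ x ∈ Set.Icc (0:ℝ) 1,
      g x = θ 0 + 2 * ∑' i : ℕ, θ (i + 1) * Real.cos (((i : ℝ) + 1) * Real.pi * x))
    {k m : ℕ} (hkm : k < m) :
    |skm g k m| ≤ |θ m| + |θ (m + k)| + |θ (m - k)| := by
  let G : ℝ → ℝ := fun x =>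
    θ 0 + 2 * ∑' i : ℕ, θ (i + 1) * Real.cos (((i : ℝ) + 1) * Real.pi * x)
  have hG : Continuous G := by
    refine continuous_const.add (continuous_const.mul
      (continuous_tsum (fun i => by fun_prop) hθ fun i x => ?_))
    rw [norm_mul]
    exact mul_le_of_le_one_right (abs_nonneg _) (Real.abs_cos_le_one _)
  have hcoef {j : ℕ} (hj : j ≠ 0) :
      ∫ x in (0:ℝ)..1, G x * Real.cos ((j : ℝ) * Real.pi * x) = θ j :=
    integral_cosine_series_mul_cos hθ hj
  have hskm : skm g k m =
      ∫ x in (0:ℝ)..1, G x * (fk k x) ^ 2 * Real.cos ((m : ℝ) * Real.pi * x) := by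
    refine intervalIntegral.integral_congr fun x hx => ?_
    rw [Set.uIcc_of_le zero_le_one] at hx
    simp only [G, hg x hx]
  rcases eq_or_ne k 0 with rfl | hk
  · have h : skm g 0 m = θ m := by
      rw [hskm, ← hcoef (by omega : m ≠ 0)]
      simp [fk]
    rw [h]
    linarith [abs_nonneg (θ (m + 0)), abs_nonneg (θ (m - 0))]
  · have hpt (x : ℝ) : G x * (fk k x) ^ 2 * Real.cos ((m : ℝ) * Real.pi * x) =
        G x * Real.cos ((m : ℝ) * Real.pi * x) +
          1 / 2 * (G x * Real.cos (((m + k : ℕ) : ℝ) * Real.pi * x) +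
            G x * Real.cos (((m - k : ℕ) : ℝ) * Real.pi * x)) := by
      have h1 : (fk k x) ^ 2 = 1 + Real.cos (k * Real.pi * x) := by
        rw [fk, if_neg hk, mul_pow, Real.sq_sqrt (by norm_num), Real.cos_sq]
        ring_nf
      rw [h1, Nat.cast_sub hkm.le, Nat.cast_add, sub_mul, sub_mul,
        add_mul (m : ℝ), add_mul ((m : ℝ) * Real.pi), Real.cos_sub, Real.cos_add]
      ring
    have h : skm g k m = θ m + 1 / 2 * (θ (m + k) + θ (m - k)) := by
      have hint (j : ℕ) : IntervalIntegrable
          (fun x => G x * Real.cos ((j : ℝ) * Real.pi * x)) volume 0 1 :=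
        Continuous.intervalIntegrable (by fun_prop) _ _
      rw [hskm, funext hpt, intervalIntegral.integral_add (hint m)
        (((hint (m + k)).add (hint (m - k))).const_mul _),
        intervalIntegral.integral_const_mul, intervalIntegral.integral_add (hint _) (hint _),
        hcoef (by omega), hcoef (by omega), hcoef (by omega)]
    rw [h, abs_le]
    constructor <;>
      linarith [neg_abs_le (θ m), le_abs_self (θ m), neg_abs_le (θ (m + k)),
        le_abs_self (θ (m + k)), neg_abs_le (θ (m - k)), le_abs_self (θ (m - k)),
        abs_nonneg (θ (m + k)), abs_nonneg (θ (m - k))]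

theorem tsum_abs_skm_le {α Q : ℝ} (hα : 1 / 2 < α) {g : ℝ → ℝ}
    (hg : memThetaS α Q g) {k N : ℕ} (hkN : k < N) :
    ∑' m : ℕ, |skm g k (N + m)| ≤
      3 * (Q + 2 ^ (2 * α) / (2 * α - 1)) * ((N - k : ℕ) : ℝ) ^ (1 / 2 - α) := by
  obtain ⟨θ, hg, hs, hQ⟩ := hg
  have htail {M : ℕ} (hM : 1 ≤ M) := summable_abs_tail_of_weighted hα hs hQ hM
  have hθ : Summable (fun i : ℕ => |θ (i + 1)|) := by
    simpa only [add_comm] using (htail le_rfl).1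
  have hQ0 : 0 ≤ Q := le_trans (tsum_nonneg fun i => by positivity) hQ
  have hα' : 0 < 2 * α - 1 := by linarith
  have hK : 0 ≤ Q + 2 ^ (2 * α) / (2 * α - 1) := by positivity
  have hmono {M : ℕ} (hM : N - k ≤ M) : ∑' j : ℕ, |θ (M + j)| ≤
      (Q + 2 ^ (2 * α) / (2 * α - 1)) * ((N - k : ℕ) : ℝ) ^ (1 / 2 - α) := by
    refine (htail (by omega)).2.trans (mul_le_mul_of_nonneg_left ?_ hK)
    exact Real.rpow_le_rpow_of_nonpos (by exact_mod_cast (by omega : 0 < N - k))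
      (by exact_mod_cast hM) (by linarith)
  have hle (j : ℕ) : |skm g k (N + j)| ≤ |θ (N + j)| + |θ (N + k + j)| + |θ (N - k + j)| := by
    have h := abs_skm_le hθ hg (k := k) (m := N + j) (by omega)
    rwa [show N + j + k = N + k + j by omega, show N + j - k = N - k + j by omega] at h
  have h1 := (htail (M := N) (by omega)).1
  have h2 := (htail (M := N + k) (by omega)).1
  have h3 := (htail (M := N - k) (by omega)).1
  have hsum := (h1.add h2).add h3
  refine ((Summable.of_nonneg_of_le (fun _ => abs_nonneg _) hle hsum).tsum_le_tsum hle
    hsum).trans ?_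
  rw [(h1.add h2).tsum_add h3, h1.tsum_add h2]
  linarith [hmono (M := N) (by omega), hmono (M := N + k) (by omega), hmono (M := N - k) le_rfl]

/-- Tail bound for the absolute Fourier coefficients of `g f_k²`, uniformly over
the Sobolev s-ellipsoid: `Σ_{m ≥ ⌊n^γ⌋} |s_{k,m}| ≤ C n^{γ(1/2−α)}` for
`k ≤ c n^γ`; and for `k = 0` the full sum `Σ_{m≥1} |s_{0,m}|` is bounded. -/
theorem tail_coefficient_bound (α Q γ c : ℝ)
    (hα : 1 / 2 < α) (hQ : 0 < Q) (hγ : 0 < γ) (hc0 : 0 < c) (hc1 : c < 1) :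
    (∃ C > (0:ℝ), ∃ n₀ : ℕ, ∀ n : ℕ, n₀ ≤ n → ∀ g : ℝ → ℝ, memThetaS α Q g →
      ∀ k : ℕ, (k : ℝ) ≤ c * (n : ℝ) ^ γ →
        ∑' m : ℕ, |skm g k (⌊(n : ℝ) ^ γ⌋₊ + m)| ≤ C * (n : ℝ) ^ (γ * (1 / 2 - α)))
    ∧ (∃ C > (0:ℝ), ∀ g : ℝ → ℝ, memThetaS α Q g →
        ∑' m : ℕ, |skm g 0 (m + 1)| ≤ C) := by
  have hα' : 0 < 2 * α - 1 := by linarith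
  have hK : 0 < 3 * (Q + 2 ^ (2 * α) / (2 * α - 1)) := by positivity
  refine ⟨⟨3 * (Q + 2 ^ (2 * α) / (2 * α - 1)) * ((1 - c) / 2) ^ (1 / 2 - α),
    mul_pos hK (Real.rpow_pos_of_pos (by linarith) _), ?_⟩, _, hK, fun g hg => ?_⟩
  · obtain ⟨n₀, hn₀⟩ := Filter.eventually_atTop.mp
      (((tendsto_rpow_atTop hγ).comp tendsto_natCast_atTop_atTop).eventually_ge_atTop
        (2 / (1 - c)))
    refine ⟨n₀, fun n hn g hg k hk => ?_⟩
    have hT : 2 / (1 - c) ≤ (n : ℝ) ^ γ := hn₀ n hn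
    have hc : 0 < 1 - c := by linarith
    rw [Real.rpow_mul (Nat.cast_nonneg n)]
    set T := (n : ℝ) ^ γ
    rw [div_le_iff₀ hc] at hT
    have hfloor := Nat.lt_floor_add_one T
    have hT0 : 0 < T := by
      by_contra! h
      nlinarith
    have hkN : k < ⌊T⌋₊ := by
      have h : (k : ℝ) < ⌊T⌋₊ := by linarith
      exact_mod_cast h
    have hlow : (1 - c) / 2 * T ≤ ((⌊T⌋₊ - k : ℕ) : ℝ) := by
      rw [Nat.cast_sub hkN.le]
      linarith
    refine (tsum_abs_skm_le hα hg hkN).trans ?_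
    rw [mul_assoc _ (((1 - c) / 2) ^ (1 / 2 - α)), ← Real.mul_rpow (by linarith) hT0.le]
    exact mul_le_mul_of_nonneg_left
      (Real.rpow_le_rpow_of_nonpos (by positivity) hlow (by linarith)) hK.le
  · simpa [add_comm] using tsum_abs_skm_le hα hg (k := 0) (N := 1) one_pos


end
end

section
/- Let n > 16, let D be the (n−1)×(n−1) matrix with D_{ij} = √(2/n)·sin(ijπ/n), and let J_n be the (n−1)×(n−1) diagonal matrix with (J_n)_{ii} = √n for ⌊√n⌋+1 ≤ i ≤ 2⌊√n⌋ and 0 otherwise. Then for every real (n−1)×(n−1) matrix A, tr(J_n·D·A·D) ≤ (n + 5·n^{3/2} + 8·n^{3/2}·(1 + log n)) · max_{1≤i,j≤n−1} |A_{ij}|, where log denotes the binary logarithm. -/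
noncomputable section

/-- The discrete sine transform matrix `D`, `D_{ij} = √(2/n)·sin(ijπ/n)`
(indices running from 1 to n−1, realized by `Fin (n−1)` shifted by one). -/
def Dmat (n : ℕ) : Matrix (Fin (n - 1)) (Fin (n - 1)) ℝ :=
  Matrix.of fun i j =>
    Real.sqrt (2 / n) * Real.sin ((((i : ℕ) + 1) : ℝ) * (((j : ℕ) + 1) : ℝ) * Real.pi / n)

/-- The spectral cut-off matrix `J_n`: diagonal with `(J_n)_{ii} = √n` for
`⌊√n⌋+1 ≤ i ≤ 2⌊√n⌋` and `0` otherwise. -/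
def Jmat (n : ℕ) : Matrix (Fin (n - 1)) (Fin (n - 1)) ℝ :=
  Matrix.diagonal fun i =>
    if Nat.sqrt n + 1 ≤ (i : ℕ) + 1 ∧ (i : ℕ) + 1 ≤ 2 * Nat.sqrt n then Real.sqrt n else 0

/-- Summation of an arithmetic progression of cosines. -/
lemma two_mul_sin_half_mul_sum_cos (θ : ℝ) {p q : ℕ} (hpq : p ≤ q) :
    2 * Real.sin (θ / 2) * ∑ l ∈ Finset.Ico p q, Real.cos (((l : ℝ) + 1) * θ)
      = Real.sin (((q : ℝ) + 1 / 2) * θ) - Real.sin (((p : ℝ) + 1 / 2) * θ) := by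
  induction q, hpq using Nat.le_induction with
  | base => simp
  | succ q hq ih =>
    rw [Finset.sum_Ico_succ_top hq, mul_add, ih]
    have h1 : ((q + 1 : ℕ) + 1 / 2 : ℝ) * θ = ((q : ℝ) + 1) * θ + θ / 2 := by push_cast; ring
    have h2 : ((q : ℝ) + 1 / 2) * θ = ((q : ℝ) + 1) * θ - θ / 2 := by ring
    rw [h1, h2, Real.sin_add, Real.sin_sub]
    ring

lemma abs_sum_cos_le_inv {θ c : ℝ} (hc : 0 < c) (h : c ≤ |Real.sin (θ / 2)|) {p q : ℕ}
    (hpq : p ≤ q) :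
    |∑ l ∈ Finset.Ico p q, Real.cos (((l : ℝ) + 1) * θ)| ≤ c⁻¹ := by
  have key := congrArg abs (two_mul_sin_half_mul_sum_cos θ hpq)
  rw [abs_mul, abs_mul, abs_two] at key
  have h3 := (abs_sub (Real.sin (((q : ℝ) + 1 / 2) * θ)) (Real.sin (((p : ℝ) + 1 / 2) * θ))).trans
    (add_le_add (Real.abs_sin_le_one _) (Real.abs_sin_le_one _))
  have h4 := mul_le_mul_of_nonneg_right h
    (abs_nonneg (∑ l ∈ Finset.Ico p q, Real.cos (((l : ℝ) + 1) * θ)))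
  rw [← one_div, le_div_iff₀ hc]
  linarith

/-- Jordan's inequality, rescaled. -/
lemma div_le_sin_mul_pi_div {n x : ℝ} (hn : 0 < n) (hx : 0 ≤ x) (hxn : x ≤ n) :
    x / n ≤ Real.sin (x * Real.pi / n / 2) := by
  have h1 : x * Real.pi / n / 2 = x / n * (Real.pi / 2) := by ring
  have h2 : x / n ≤ 1 := (div_le_one hn).2 hxn
  have h := Real.mul_le_sin (x := x / n * (Real.pi / 2)) (by positivity)
    (mul_le_of_le_one_left (by positivity) h2)
  rw [h1]
  convert h using 1
  field_simp

/-- The sum of `cos (l x π / n)` over `⌊√n⌋ < l ≤ 2⌊√n⌋`. -/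
def cosSum (n : ℕ) (x : ℝ) : ℝ :=
  ∑ l ∈ Finset.Ico (Nat.sqrt n) (2 * Nat.sqrt n), Real.cos (((l : ℝ) + 1) * (x * Real.pi / n))

lemma abs_cosSum_le_sqrt (n : ℕ) (x : ℝ) : |cosSum n x| ≤ Nat.sqrt n := by
  refine (Finset.abs_sum_le_sum_abs _ _).trans ?_
  refine (Finset.sum_le_card_nsmul _ _ 1 fun l _ => Real.abs_cos_le_one _).trans ?_
  simp [two_mul]

lemma cosSum_neg (n : ℕ) (x : ℝ) : cosSum n (-x) = cosSum n x := by
  refine Finset.sum_congr rfl fun l _ => ?_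
  rw [← Real.cos_neg]
  ring_nf

lemma abs_cosSum_le_div {n : ℕ} {x : ℝ} (hx : 0 < x) (hxn : x ≤ n) :
    |cosSum n x| ≤ n * x⁻¹ := by
  have hn : (0 : ℝ) < n := hx.trans_le hxn
  refine (abs_sum_cos_le_inv (c := x / n) (by positivity) ?_ (by omega)).trans (le_of_eq ?_)
  · exact (div_le_sin_mul_pi_div hn hx.le hxn).trans (le_abs_self _)
  · rw [inv_div, div_eq_mul_inv]

lemma abs_cosSum_le_div' {n : ℕ} {x : ℝ} (hnx : n ≤ x) (hx : x < 2 * n) :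
    |cosSum n x| ≤ n * (2 * n - x)⁻¹ := by
  have hn : (0 : ℝ) < n := by linarith
  have h0 : 0 < 2 * n - x := by linarith
  refine (abs_sum_cos_le_inv (c := (2 * n - x) / n) (by positivity) ?_ (by omega)).trans
    (le_of_eq ?_)
  · refine (div_le_sin_mul_pi_div hn h0.le (by linarith)).trans (le_trans (le_of_eq ?_)
      (le_abs_self _))
    rw [← Real.sin_pi_sub]
    congr 1
    field_simp
    ring
  · rw [inv_div, div_eq_mul_inv]

/-- The entries of `D J D`. -/
lemma Dmat_mul_Jmat_mul_Dmat_apply {n : ℕ} (hn : 16 < n) (i j : Fin (n - 1)) :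
    (Dmat n * Jmat n * Dmat n) i j
      = (Real.sqrt n)⁻¹ * (cosSum n ((i : ℝ) - j) - cosSum n ((i : ℝ) + j + 2)) := by
  have hk : 2 * Nat.sqrt n ≤ n - 1 := by
    have h1 := Nat.sqrt_le n
    have h2 : 4 ≤ Nat.sqrt n := Nat.le_sqrt.2 (by omega)
    have : 4 * Nat.sqrt n ≤ n := le_trans (Nat.mul_le_mul_right _ h2) h1
    omega
  have hn0 : (0 : ℝ) < n := by positivity
  have hs : Real.sqrt (2 / n) * Real.sqrt n * Real.sqrt (2 / n) = 2 * (Real.sqrt n)⁻¹ := by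
    rw [mul_right_comm, Real.mul_self_sqrt (by positivity)]
    have := Real.sq_sqrt hn0.le
    have h0 : Real.sqrt n ≠ 0 := by positivity
    field_simp
    exact this
  have hterm : ∀ l : ℕ,
      2 * (Real.sin (((i : ℕ) + 1 : ℝ) * ((l : ℝ) + 1) * Real.pi / n)
        * Real.sin (((l : ℝ) + 1) * ((j : ℕ) + 1 : ℝ) * Real.pi / n))
      = Real.cos (((l : ℝ) + 1) * (((i : ℝ) - j) * Real.pi / n))
        - Real.cos (((l : ℝ) + 1) * (((i : ℝ) + j + 2) * Real.pi / n)) := by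
    intro l
    rw [show ((l : ℝ) + 1) * (((i : ℝ) - j) * Real.pi / n)
        = ((i : ℕ) + 1 : ℝ) * ((l : ℝ) + 1) * Real.pi / n
          - ((l : ℝ) + 1) * ((j : ℕ) + 1 : ℝ) * Real.pi / n by ring,
      show ((l : ℝ) + 1) * (((i : ℝ) + j + 2) * Real.pi / n)
        = ((i : ℕ) + 1 : ℝ) * ((l : ℝ) + 1) * Real.pi / n
          + ((l : ℝ) + 1) * ((j : ℕ) + 1 : ℝ) * Real.pi / n by ring,
      Real.cos_sub, Real.cos_add]
    ring
  have hset : Finset.Ico (Nat.sqrt n) (2 * Nat.sqrt n)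
      = (Finset.range (n - 1)).filter
        fun l => Nat.sqrt n + 1 ≤ l + 1 ∧ l + 1 ≤ 2 * Nat.sqrt n := by
    ext l
    simp only [Finset.mem_Ico, Finset.mem_filter, Finset.mem_range]
    omega
  rw [cosSum, cosSum, ← Finset.sum_sub_distrib, hset, Finset.sum_filter, Finset.mul_sum,
    ← Fin.sum_univ_eq_sum_range (fun l : ℕ => (Real.sqrt n)⁻¹ *
      if Nat.sqrt n + 1 ≤ l + 1 ∧ l + 1 ≤ 2 * Nat.sqrt n then
        Real.cos (((l : ℝ) + 1) * (((i : ℝ) - j) * Real.pi / n))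
        - Real.cos (((l : ℝ) + 1) * (((i : ℝ) + j + 2) * Real.pi / n)) else 0),
    Matrix.mul_apply]
  refine Finset.sum_congr rfl fun l _ => ?_
  rw [Jmat, Matrix.mul_diagonal]
  simp only [Dmat, Matrix.of_apply]
  split_ifs
  · rw [← hterm]
    linear_combination Real.sin (((i : ℕ) + 1 : ℝ) * (((l : ℕ) : ℝ) + 1) * Real.pi / n)
        * Real.sin ((((l : ℕ) : ℝ) + 1) * ((j : ℕ) + 1 : ℝ) * Real.pi / n) * hs
  · simp

lemma sum_range_sub_left_le {g : ℕ → ℝ} (hg : ∀ d, 0 ≤ g d) (hg0 : g 0 = 0) (a N : ℕ) :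
    ∑ b ∈ Finset.range N, g (a - b) ≤ ∑ d ∈ Finset.range (a + 1), g d := by
  induction a generalizing N with
  | zero => simp [hg0]
  | succ a ih =>
    cases N with
    | zero => simpa using Finset.sum_nonneg fun d _ => hg d
    | succ N =>
      rw [Finset.sum_range_succ', Finset.sum_range_succ _ (a + 1)]
      simpa using ih N

lemma sum_range_sub_right_le {g : ℕ → ℝ} (hg : ∀ d, 0 ≤ g d) (hg0 : g 0 = 0) (a N : ℕ) :
    ∑ b ∈ Finset.range N, g (b - a) ≤ ∑ d ∈ Finset.range N, g d := by
  induction a generalizing N with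
  | zero => simp
  | succ a ih =>
    cases N with
    | zero => simp
    | succ N =>
      rw [Finset.sum_range_succ', Finset.sum_range_succ]
      simp only [Nat.add_sub_add_right, Nat.zero_sub, hg0]
      linarith [ih N, hg N]

lemma sum_range_inv_le_harmonic {m N : ℕ} (h : m ≤ N + 1) :
    ∑ d ∈ Finset.range m, ((d : ℝ))⁻¹ ≤ harmonic N := by
  calc ∑ d ∈ Finset.range m, ((d : ℝ))⁻¹
      ≤ ∑ d ∈ Finset.range (N + 1), ((d : ℝ))⁻¹ :=
        Finset.sum_le_sum_of_subset_of_nonneg (Finset.range_mono h) fun _ _ _ => by positivity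
    _ = harmonic N := by
        rw [Finset.sum_range_succ']
        simp [harmonic]

lemma abs_cosSum_sub_le {n i j : ℕ} (hi : i < n) (hj : j < n) :
    |cosSum n ((i : ℝ) - j)| ≤ (if i = j then (Nat.sqrt n : ℝ) else 0)
      + n * (((i - j : ℕ) : ℝ)⁻¹ + ((j - i : ℕ) : ℝ)⁻¹) := by
  have hi' : (i : ℝ) < n := by exact_mod_cast hi
  have hj' : (j : ℝ) < n := by exact_mod_cast hj
  have hi0 : (0 : ℝ) ≤ i := by positivity
  have hj0 : (0 : ℝ) ≤ j := by positivity
  rcases lt_trichotomy i j with h | h | h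
  · have h' : (i : ℝ) < j := by exact_mod_cast h
    rw [if_neg h.ne, Nat.sub_eq_zero_of_le h.le, Nat.cast_sub h.le, ← neg_sub, cosSum_neg]
    simpa using abs_cosSum_le_div (n := n) (x := (j : ℝ) - i) (by linarith) (by linarith)
  · subst h
    simpa using abs_cosSum_le_sqrt n 0
  · have h' : (j : ℝ) < i := by exact_mod_cast h
    rw [if_neg h.ne', Nat.sub_eq_zero_of_le h.le, Nat.cast_sub h.le]
    simpa using abs_cosSum_le_div (n := n) (x := (i : ℝ) - j) (by linarith) (by linarith)

lemma abs_cosSum_add_le {n i j : ℕ} (hi : i < n - 1) (hj : j < n - 1) :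
    |cosSum n ((i : ℝ) + j + 2)|
      ≤ n * (((j + 1 : ℕ) : ℝ)⁻¹ + ((n - 1 - j : ℕ) : ℝ)⁻¹) := by
  have hi' : (i : ℝ) + 1 < n := by exact_mod_cast (by omega : i + 1 < n)
  have hj' : (j : ℝ) + 1 < n := by exact_mod_cast (by omega : j + 1 < n)
  have hi0 : (0 : ℝ) ≤ i := by positivity
  have hj0 : (0 : ℝ) ≤ j := by positivity
  have hc : ((n - 1 - j : ℕ) : ℝ) = n - 1 - j := by
    rw [Nat.cast_sub hj.le, Nat.cast_sub (by omega)]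
    simp
  rw [hc, mul_add]
  have hpos : 0 < (n : ℝ) - 1 - j := by linarith
  push_cast
  rcases le_total ((i : ℝ) + j + 2) n with h | h
  · refine (abs_cosSum_le_div (by positivity) h).trans (le_add_of_le_of_nonneg ?_ (by positivity))
    exact mul_le_mul_of_nonneg_left (inv_anti₀ (by positivity) (by linarith)) (by positivity)
  · refine (abs_cosSum_le_div' h (by linarith)).trans (le_add_of_nonneg_of_le (by positivity) ?_)
    exact mul_le_mul_of_nonneg_left (inv_anti₀ hpos (by linarith)) (by positivity)

/-- Each row of `D J D` has absolute sum at most `(⌊√n⌋ + 4 n H_{n-1}) / √n`. -/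
lemma sum_abs_Dmat_mul_Jmat_mul_Dmat_le {n : ℕ} (hn : 16 < n) (i : Fin (n - 1)) :
    ∑ j, |(Dmat n * Jmat n * Dmat n) i j|
      ≤ (Real.sqrt n)⁻¹ * (Nat.sqrt n + 4 * n * harmonic (n - 1)) := by
  have hi := i.isLt
  have hentry : ∀ j : Fin (n - 1), |(Dmat n * Jmat n * Dmat n) i j| ≤
      (Real.sqrt n)⁻¹ * (((if (i : ℕ) = (j : ℕ) then (Nat.sqrt n : ℝ) else 0)
        + n * ((((i : ℕ) - j : ℕ) : ℝ)⁻¹ + (((j : ℕ) - i : ℕ) : ℝ)⁻¹))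
        + n * ((((j : ℕ) + 1 : ℕ) : ℝ)⁻¹ + ((n - 1 - j : ℕ) : ℝ)⁻¹)) := by
    intro j
    have hj := j.isLt
    rw [Dmat_mul_Jmat_mul_Dmat_apply hn, abs_mul, abs_of_nonneg (by positivity)]
    gcongr
    exact (abs_sub _ _).trans
      (add_le_add (abs_cosSum_sub_le (by omega) (by omega)) (abs_cosSum_add_le hi hj))
  refine (Finset.sum_le_sum fun j _ => hentry j).trans ?_
  rw [← Finset.mul_sum]
  refine mul_le_mul_of_nonneg_left ?_ (by positivity)
  rw [Fin.sum_univ_eq_sum_range (fun j : ℕ => ((if (i : ℕ) = j then (Nat.sqrt n : ℝ) else 0)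
        + n * ((((i : ℕ) - j : ℕ) : ℝ)⁻¹ + ((j - i : ℕ) : ℝ)⁻¹))
        + n * (((j + 1 : ℕ) : ℝ)⁻¹ + ((n - 1 - j : ℕ) : ℝ)⁻¹))]
  simp only [Finset.sum_add_distrib, ← Finset.mul_sum]
  have hg : ∀ d : ℕ, (0 : ℝ) ≤ (d : ℝ)⁻¹ := fun d => by positivity
  have hg0 : ((0 : ℕ) : ℝ)⁻¹ = 0 := by simp
  have h0 : ∑ j ∈ Finset.range (n - 1), (if (i : ℕ) = j then (Nat.sqrt n : ℝ) else 0)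
      = Nat.sqrt n := by
    rw [Finset.sum_ite_eq, if_pos (Finset.mem_range.2 hi)]
  have h1 := (sum_range_sub_left_le hg hg0 i (n - 1)).trans
    (sum_range_inv_le_harmonic (N := n - 1) (by omega))
  have h2 := (sum_range_sub_right_le hg hg0 i (n - 1)).trans
    (sum_range_inv_le_harmonic (N := n - 1) (by omega))
  have h3 : ∑ j ∈ Finset.range (n - 1), (((j + 1 : ℕ) : ℝ))⁻¹ = harmonic (n - 1) := by
    simp [harmonic]
  have h4 := (sum_range_sub_left_le hg hg0 (n - 1) (n - 1)).trans
    (sum_range_inv_le_harmonic (N := n - 1) le_rfl)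
  rw [h0, h3]
  have h5 := mul_le_mul_of_nonneg_left (add_le_add (add_le_add h1 h2) h4)
    (Nat.cast_nonneg (α := ℝ) n)
  linarith

/-- The trace of a product is at most the entrywise `ℓ¹` norm of one factor times the largest
entry of the other. -/
lemma trace_mul_le_sum_abs_mul_iSup {m : ℕ} (K A : Matrix (Fin m) (Fin m) ℝ) :
    Matrix.trace (K * A) ≤ (∑ i, ∑ j, |K i j|) * ⨆ i, ⨆ j, |A i j| := by
  simp only [Matrix.trace, Matrix.diag_apply, Matrix.mul_apply, Finset.sum_mul]
  refine Finset.sum_le_sum fun i _ => Finset.sum_le_sum fun j _ => ?_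
  refine (le_abs_self _).trans ?_
  rw [abs_mul]
  refine mul_le_mul_of_nonneg_left ?_ (abs_nonneg _)
  exact (le_ciSup (f := fun i => |A j i|) (Set.finite_range _).bddAbove i).trans
    (le_ciSup (f := fun j => ⨆ i, |A j i|) (Set.finite_range _).bddAbove j)

lemma harmonic_pred_le_one_add_logb {n : ℕ} (hn : 1 < n) :
    (harmonic (n - 1) : ℝ) ≤ 1 + Real.logb 2 n := by
  have h1 := harmonic_le_one_add_log (n - 1)
  have h2 : Real.log ((n - 1 : ℕ) : ℝ) ≤ Real.log n :=
    Real.log_le_log (by exact_mod_cast (by omega : 0 < n - 1)) (by exact_mod_cast Nat.sub_le n 1)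
  have h3 : Real.log n ≤ Real.logb 2 n := by
    rw [Real.logb, le_div_iff₀ (Real.log_pos one_lt_two)]
    refine mul_le_of_le_one_right (Real.log_natCast_nonneg n) ?_
    linarith [Real.log_two_lt_d9]
  linarith

/-- Trace bound: `tr(J_n D A D) ≤ (n + 5 n^{3/2} + 8 n^{3/2}(1 + log n)) · max_{i,j} |A_{ij}|`,
with the binary logarithm. -/
theorem trace_JDAD_bound (n : ℕ) (hn : 16 < n)
    (A : Matrix (Fin (n - 1)) (Fin (n - 1)) ℝ) :
    Matrix.trace (Jmat n * Dmat n * A * Dmat n)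
      ≤ ((n : ℝ) + 5 * (n : ℝ) ^ ((3 : ℝ) / 2)
          + 8 * (n : ℝ) ^ ((3 : ℝ) / 2) * (1 + Real.logb 2 n))
        * (⨆ i : Fin (n - 1), ⨆ j : Fin (n - 1), |A i j|) := by
  have hn0 : (0 : ℝ) < n := by positivity
  have hcycle : Matrix.trace (Jmat n * Dmat n * A * Dmat n)
      = Matrix.trace (Dmat n * Jmat n * Dmat n * A) := by
    rw [Matrix.trace_mul_comm]
    simp only [Matrix.mul_assoc]
  rw [hcycle]
  refine (trace_mul_le_sum_abs_mul_iSup _ _).trans ?_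
  refine mul_le_mul_of_nonneg_right ?_
    (Real.iSup_nonneg fun i => Real.iSup_nonneg fun j => abs_nonneg _)
  refine (Finset.sum_le_sum fun i _ => sum_abs_Dmat_mul_Jmat_mul_Dmat_le hn i).trans ?_
  rw [Finset.sum_const, Finset.card_univ, Fintype.card_fin, nsmul_eq_mul]
  have hpow : (n : ℝ) ^ ((3 : ℝ) / 2) = n * Real.sqrt n := by
    rw [Real.sqrt_eq_rpow, ← Real.rpow_one_add' hn0.le (by norm_num)]
    norm_num
  have hinv : (Real.sqrt n)⁻¹ * n = Real.sqrt n := by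
    rw [inv_mul_eq_div, Real.div_sqrt]
  have hL : (harmonic (n - 1) : ℝ) ≤ 1 + Real.logb 2 n := harmonic_pred_le_one_add_logb (by omega)
  have hH : (0 : ℝ) ≤ harmonic (n - 1) := by
    exact_mod_cast (harmonic_pos (by omega)).le
  have hk : (Real.sqrt n)⁻¹ * Nat.sqrt n ≤ 1 := by
    rw [inv_mul_le_iff₀ (by positivity), mul_one]
    exact Real.nat_sqrt_le_real_sqrt
  have hpred : ((n - 1 : ℕ) : ℝ) ≤ n := by exact_mod_cast Nat.sub_le n 1
  have hs : 0 ≤ n * Real.sqrt n := by positivity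
  calc ((n - 1 : ℕ) : ℝ) * ((Real.sqrt n)⁻¹ * (Nat.sqrt n + 4 * n * harmonic (n - 1)))
      ≤ n * ((Real.sqrt n)⁻¹ * (Nat.sqrt n + 4 * n * harmonic (n - 1))) := by gcongr
    _ = n * ((Real.sqrt n)⁻¹ * Nat.sqrt n)
        + 4 * (n * ((Real.sqrt n)⁻¹ * n)) * harmonic (n - 1) := by ring
    _ ≤ n * 1 + 4 * (n * Real.sqrt n) * (1 + Real.logb 2 n) := by
        rw [hinv]
        gcongr
    _ ≤ _ := by
        rw [hpow]
        have := mul_nonneg hs (hH.trans hL)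
        linarith

end
end
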